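/- Let g be a Lie algebra over a field k and let B : g × g → k be a symmetric bilinear form. Define the trilinear symmetric bracket {a,b,c} := B(a,b)·c + B(a,c)·b + B(b,c)·a. Then the generalized Jacobi identity of order 3 holds: for all a,b,c,d ∈ g, [a,{b,c,d}] + [b,{a,c,d}] + [c,{a,b,d}] + [d,{a,b,c}] = 0. -/

import Mathlib

/-- For a Lie algebra `g` over a field `k` with a symmetric bilinear form `B`,
the trilinear symmetric bracket `{a,b,c} := B(a,b)•c + B(a,c)•b + B(b,c)•a` satisfies
the generalized Jacobi identity of order 3:
`[a,{b,c,d}] + [b,{a,c,d}] + [c,{a,b,d}] + [d,{a,b,c}] = 0`. -/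
theorem trilinear_bracket_jacobi
    {k : Type*} [Field k] {g : Type*} [LieRing g] [LieAlgebra k g]
    (B : g →ₗ[k] g →ₗ[k] k)
    (hB_symm : ∀ a b : g, B a b = B b a)
    (T : g → g → g → g)
    (hT : ∀ a b c : g, T a b c = B a b • c + B a c • b + B b c • a) :
    ∀ a b c d : g,
      ⁅a, T b c d⁆ + ⁅b, T a c d⁆ + ⁅c, T a b d⁆ + ⁅d, T a b c⁆ = 0 := by
  intro a b c d
  simp only [hT, lie_add, lie_smul]
  rw [← lie_skew b a, ← lie_skew c a, ← lie_skew c b, ← lie_skew d a, ← lie_skew d b,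
    ← lie_skew d c]
  module
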